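/- Let a and b be strings over Σ whose concatenation a·b is nonempty. Then a·b ∈ 𝒟* if and only if there exist integers k and ℓ with 0 ≤ k ≤ min(m, |a|) and 0 ≤ ℓ ≤ min(m, |b|) such that: the string obtained from a by removing its last k characters belongs to 𝒟*, the concatenation of the last k characters of a with the first ℓ characters of b is a word of 𝒟, and the string obtained from b by removing its first ℓ characters belongs to 𝒟*. -/

import Mathlib

/-- `s` belongs to the Kleene star of the dictionary `D`:
`s` is a concatenation of finitely many (possibly zero) words of `D`. -/
def InStar {σ : Type*} (D : Finset (List σ)) (s : List σ) : Prop :=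
  ∃ fs : List (List σ), (∀ f ∈ fs, f ∈ D) ∧ fs.flatten = s

theorem InStar.append {σ : Type*} {D : Finset (List σ)} {s t : List σ}
    (hs : InStar D s) (ht : InStar D t) : InStar D (s ++ t) := by
  obtain ⟨fs, hfs, rfl⟩ := hs
  obtain ⟨gs, hgs, rfl⟩ := ht
  refine ⟨fs ++ gs, fun f hf => ?_, List.flatten_append⟩
  exact (List.mem_append.1 hf).elim (hfs f) (hgs f)

theorem InStar.of_mem {σ : Type*} {D : Finset (List σ)} {d : List σ} (hd : d ∈ D) :
    InStar D d :=
  ⟨[d], by simpa using hd, by simp⟩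

theorem InStar.nil {σ : Type*} (D : Finset (List σ)) : InStar D [] :=
  ⟨[], by simp, rfl⟩

/-- Any cut of a nonempty concatenation of dictionary words falls inside, or on the boundary of,
one of the words. -/
theorem exists_word_at_cut {σ : Type*} {D : Finset (List σ)} {fs : List (List σ)}
    (hfs : ∀ f ∈ fs, f ∈ D) (hne : fs ≠ []) {a b : List σ} (h : fs.flatten = a ++ b) :
    ∃ a₁ a₂ b₁ b₂, a = a₁ ++ a₂ ∧ b = b₁ ++ b₂ ∧
      InStar D a₁ ∧ a₂ ++ b₁ ∈ D ∧ InStar D b₂ := by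
  induction fs generalizing a with
  | nil => exact absurd rfl hne
  | cons f gs ih =>
    have hf : f ∈ D := hfs f (by simp)
    have hgs : ∀ g ∈ gs, g ∈ D := fun g hg => hfs g (by simp [hg])
    rw [List.flatten_cons, List.append_eq_append_iff] at h
    rcases h with ⟨c, rfl, hc⟩ | ⟨c, rfl, rfl⟩
    · by_cases hnil : gs = []
      · subst hnil
        obtain ⟨rfl, rfl⟩ : c = [] ∧ b = [] := by simpa using hc.symm
        exact ⟨[], f, [], [], by simp, rfl, .nil D, by simpa using hf, .nil D⟩
      · obtain ⟨a₁, a₂, b₁, b₂, rfl, rfl, h₁, h₂, h₃⟩ := ih hgs hnil hc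
        exact ⟨f ++ a₁, a₂, b₁, b₂, by simp, rfl, (InStar.of_mem hf).append h₁, h₂, h₃⟩
    · exact ⟨[], a, c, gs.flatten, rfl, rfl, .nil D, hf, ⟨gs, hgs, rfl⟩⟩

theorem stmt2 {σ : Type*} [Fintype σ] (D : Finset (List σ)) (hD : D.Nonempty)
    (hne : ∀ d ∈ D, d ≠ []) (m : ℕ) (hm : m = D.sup List.length)
    (a b : List σ) (hab : a ++ b ≠ []) :
    InStar D (a ++ b) ↔
      ∃ k ℓ : ℕ, k ≤ min m a.length ∧ ℓ ≤ min m b.length ∧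
        InStar D (a.rdrop k) ∧ (a.rtake k ++ b.take ℓ) ∈ D ∧ InStar D (b.drop ℓ) := by
  constructor
  · rintro ⟨fs, hfs, h⟩
    have hnil : fs ≠ [] := by
      rintro rfl
      exact hab h.symm
    obtain ⟨a₁, a₂, b₁, b₂, rfl, rfl, h₁, h₂, h₃⟩ := exists_word_at_cut hfs hnil h
    have hlen : a₂.length + b₁.length ≤ m := by
      rw [hm, ← List.length_append]
      exact Finset.le_sup (f := List.length) h₂
    refine ⟨a₂.length, b₁.length, ?_, ?_, ?_, ?_, ?_⟩
    · simp; omega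
    · simp; omega
    · simpa [List.rdrop] using h₁
    · simpa [List.rtake] using h₂
    · simpa using h₃
  · rintro ⟨k, ℓ, -, -, h₁, h₂, h₃⟩
    have h := h₁.append ((InStar.of_mem h₂).append h₃)
    have ha : a.rdrop k ++ a.rtake k = a := List.take_append_drop _ a
    rwa [List.append_assoc, List.take_append_drop, ← List.append_assoc, ha] at h
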